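/- Let 𝔽 be a field with algebraic closure 𝔽̄ and let V ⊆ 𝔽̄^n be an irreducible affine variety of degree d and dimension k that is defined over 𝔽, such that the coordinates x_1,…,x_k are algebraically independent on V. Then there exist polynomials f_1,…,f_{n−k} with coefficients in 𝔽, where f_i depends only on the variables x_1,…,x_k,x_{k+i}, each of degree at most d and with f_i genuinely depending on x_{k+i}, such that V is an irreducible component of the variety U = {x ∈ 𝔽̄^n : f_1(x) = … = f_{n−k}(x) = 0}. -/

import Mathlib

open MvPolynomial

/-- The zero locus of a set of multivariate polynomials. -/
def zeroLocus (K : Type*) [Field K] (n : ℕ) (S : Set (MvPolynomial (Fin n) K)) :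
    Set (Fin n → K) := {x | ∀ f ∈ S, eval x f = 0}

/-- An affine variety is the common zero set of finitely many polynomials. -/
def IsAffineVariety (K : Type*) [Field K] (n : ℕ) (V : Set (Fin n → K)) : Prop :=
  ∃ s : Finset (MvPolynomial (Fin n) K), V = zeroLocus K n ↑s

/-- The Zariski topology on affine n-space. -/
instance zariskiTopology (K : Type*) [Field K] (n : ℕ) : TopologicalSpace (Fin n → K) :=
  TopologicalSpace.generateFrom
    {U | ∃ S : Set (MvPolynomial (Fin n) K), U = (zeroLocus K n S)ᶜ}

/-- Dimension of a subset of affine space: Krull dimension in the Zariski topology. -/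
noncomputable def vdim (K : Type*) [Field K] (n : ℕ) (V : Set (Fin n → K)) : WithBot ℕ∞ :=
  topologicalKrullDim ↥V

/-- An affine-linear subspace: zero set of polynomials of degree at most one. -/
def IsAffineSubspace (K : Type*) [Field K] (n : ℕ) (L : Set (Fin n → K)) : Prop :=
  ∃ S : Set (MvPolynomial (Fin n) K), (∀ f ∈ S, totalDegree f ≤ 1) ∧ L = zeroLocus K n S

/-- Degree of an irreducible variety: number of intersection points with a generic
(affine-linear) subspace of complementary dimension. -/
noncomputable def irrDegree (K : Type*) [Field K] (n : ℕ) (W : Set (Fin n → K)) : ℕ∞ :=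
  ⨆ (L : Set (Fin n → K)) (_ : IsAffineSubspace K n L)
    (_ : vdim K n W + vdim K n L = (n : WithBot ℕ∞)) (_ : (W ∩ L).Finite),
    ((W ∩ L).ncard : ℕ∞)

/-- Degree of a variety: sum of degrees of its irreducible components. -/
noncomputable def vdeg (K : Type*) [Field K] (n : ℕ) (V : Set (Fin n → K)) : ℕ∞ :=
  ∑' W : irreducibleComponents ↥V, irrDegree K n (Subtype.val '' (W.1 : Set ↥V))

/-- The ideal of polynomials vanishing on a set. -/
noncomputable def vanishingIdeal (K : Type*) [Field K] (n : ℕ) (V : Set (Fin n → K)) :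
    Ideal (MvPolynomial (Fin n) K) where
  carrier := {f | ∀ x ∈ V, eval x f = 0}
  add_mem' {f g} hf hg := fun x hx => by simp [hf x hx, hg x hx]
  zero_mem' := fun x hx => by simp
  smul_mem' := fun c f hf x hx => by simp [hf x hx]

/-- A variety is defined over a subfield `F` if its vanishing ideal is generated by
finitely many polynomials with coefficients in `F`. -/
def DefinedOver (F K : Type*) [Field F] [Field K] [Algebra F K] (n : ℕ)
    (V : Set (Fin n → K)) : Prop :=
  ∃ s : Finset (MvPolynomial (Fin n) F),
    vanishingIdeal K n V = Ideal.span ((MvPolynomial.map (algebraMap F K)) '' ↑s)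


namespace ICP

section Zar
variable {K : Type*} [Field K] {n : ℕ}

theorem isClosed_iff (Z : Set (Fin n → K)) :
    IsClosed Z ↔ ∃ S : Set (MvPolynomial (Fin n) K), Z = _root_.zeroLocus K n S := by
  constructor
  · intro h
    have h1 : TopologicalSpace.GenerateOpen
      {U | ∃ S : Set (MvPolynomial (Fin n) K), U = (_root_.zeroLocus K n S)ᶜ} Zᶜ := h.isOpen_compl
    suffices ∀ U : Set (Fin n → K), TopologicalSpace.GenerateOpen
      {U | ∃ S : Set (MvPolynomial (Fin n) K), U = (_root_.zeroLocus K n S)ᶜ} U →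
        ∃ S : Set (MvPolynomial (Fin n) K), U = (_root_.zeroLocus K n S)ᶜ by
      obtain ⟨S, hS⟩ := this _ h1
      exact ⟨S, compl_injective hS⟩
    intro U hU
    induction hU with
    | basic s hs => exact hs
    | univ => exact ⟨{1}, by ext x; simp [_root_.zeroLocus]⟩
    | inter s t _ _ ihs iht =>
      obtain ⟨S, rfl⟩ := ihs
      obtain ⟨T, rfl⟩ := iht
      refine ⟨{h | ∃ f ∈ S, ∃ g ∈ T, h = f * g}, ?_⟩
      ext x
      simp only [_root_.zeroLocus, Set.mem_inter_iff, Set.mem_compl_iff, Set.mem_ofPred_eq]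
      constructor
      · rintro ⟨h1, h2⟩ h3
        push Not at h1 h2
        obtain ⟨f, hf, hf'⟩ := h1
        obtain ⟨g, hg, hg'⟩ := h2
        have := h3 (f * g) ⟨f, hf, g, hg, rfl⟩
        simp [hf', hg'] at this
      · intro h
        push Not at h
        obtain ⟨_, ⟨f, hf, g, hg, rfl⟩, h⟩ := h
        simp only [map_mul, ne_eq, mul_eq_zero, not_or] at h
        exact ⟨fun h' => h.1 (h' f hf), fun h' => h.2 (h' g hg)⟩
    | sUnion S _ ih =>
      choose! T hT using ih
      refine ⟨⋃ s ∈ S, T s, ?_⟩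
      ext x
      constructor
      · rintro ⟨s, hs, hx⟩ h
        have hx' := hx
        rw [hT s hs] at hx'
        exact hx' fun f hf => h f (Set.mem_biUnion hs hf)
      · intro h
        by_contra hc
        apply h
        intro f hf
        obtain ⟨s, hs, hf⟩ := Set.mem_iUnion₂.1 hf
        by_contra hne
        apply hc
        refine ⟨s, hs, ?_⟩
        rw [hT s hs]
        exact fun h' => hne (h' f hf)
  · rintro ⟨S, rfl⟩
    rw [← isOpen_compl_iff]
    exact TopologicalSpace.GenerateOpen.basic _ ⟨S, rfl⟩

theorem mem_vI {V : Set (Fin n → K)} {f : MvPolynomial (Fin n) K} :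
    f ∈ _root_.vanishingIdeal K n V ↔ ∀ x ∈ V, eval x f = 0 := Iff.rfl

theorem closed_eq {Z : Set (Fin n → K)} (hZ : IsClosed Z) :
    _root_.zeroLocus K n (_root_.vanishingIdeal K n Z) = Z := by
  obtain ⟨S, rfl⟩ := (isClosed_iff Z).1 hZ
  ext x
  exact ⟨fun h f hf => h f (fun y hy => hy f hf), fun h f hf => hf x h⟩

theorem closed_zeroLocus (S : Set (MvPolynomial (Fin n) K)) :
    IsClosed (_root_.zeroLocus K n S) := (isClosed_iff _).2 ⟨S, rfl⟩

theorem prime_of_irr {W : Set (Fin n → K)} (hW : IsIrreducible W) :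
    (_root_.vanishingIdeal K n W).IsPrime := by
  constructor
  · intro h
    obtain ⟨x, hx⟩ := hW.1
    have : (1 : MvPolynomial (Fin n) K) ∈ _root_.vanishingIdeal K n W := h ▸ Submodule.mem_top
    simpa using this x hx
  · intro f g hfg
    have := isPreirreducible_iff_isClosed_union_isClosed.1 hW.2
      (_root_.zeroLocus K n {f}) (_root_.zeroLocus K n {g})
      (closed_zeroLocus _) (closed_zeroLocus _) ?_
    · rcases this with h | h
      · left
        intro x hx
        exact h hx f rfl
      · right
        intro x hx
        exact h hx g rfl
    · intro x hx
      have := hfg x hx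
      rw [map_mul, mul_eq_zero] at this
      rcases this with h | h
      · left; simpa [_root_.zeroLocus] using h
      · right; simpa [_root_.zeroLocus] using h

theorem irr_of_prime {W : Set (Fin n → K)}
    (hW : (_root_.vanishingIdeal K n W).IsPrime) : IsIrreducible W := by
  constructor
  · by_contra h
    rw [Set.not_nonempty_iff_eq_empty] at h
    apply hW.ne_top
    rw [Ideal.eq_top_iff_one]
    intro x hx
    simp [h] at hx
  · rw [isPreirreducible_iff_isClosed_union_isClosed]
    intro Z1 Z2 h1 h2 h
    by_contra hc
    push Not at hc
    obtain ⟨hc1, hc2⟩ := hc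
    obtain ⟨S1, rfl⟩ := (isClosed_iff Z1).1 h1
    obtain ⟨S2, rfl⟩ := (isClosed_iff Z2).1 h2
    obtain ⟨x, hx, hx1⟩ := Set.not_subset.1 hc1
    obtain ⟨y, hy, hy1⟩ := Set.not_subset.1 hc2
    simp only [_root_.zeroLocus, Set.mem_ofPred_eq, not_forall] at hx1 hy1
    obtain ⟨f, hf, hfx⟩ := hx1
    obtain ⟨g, hg, hgy⟩ := hy1
    have : f * g ∈ _root_.vanishingIdeal K n W := by
      intro z hz
      rcases h hz with h | h
      · simp [h f hf]
      · simp [h g hg]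
    rcases hW.mem_or_mem this with h | h
    · exact hfx (h x hx)
    · exact hgy (h y hy)

theorem vI_zL_prime [IsAlgClosed K] (P : Ideal (MvPolynomial (Fin n) K)) [hP : P.IsPrime] :
    _root_.vanishingIdeal K n (_root_.zeroLocus K n P) = P :=
  MvPolynomial.IsPrime.vanishingIdeal_zeroLocus (K := K) P

theorem irr_of_image {X : Type*} [TopologicalSpace X] {V : Set X} (hV : IsClosed V) {Z : Set V}
    (h : IsIrreducible (Subtype.val '' Z)) : IsIrreducible Z := by
  refine ⟨Set.image_nonempty.1 h.1, ?_⟩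
  rw [isPreirreducible_iff_isClosed_union_isClosed]
  intro Z1 Z2 h1 h2 hZ
  have := isPreirreducible_iff_isClosed_union_isClosed.1 h.2 (Subtype.val '' Z1) (Subtype.val '' Z2)
    (hV.isClosedEmbedding_subtypeVal.isClosedMap _ h1)
    (hV.isClosedEmbedding_subtypeVal.isClosedMap _ h2)
    (by rw [← Set.image_union]; exact Set.image_mono hZ)
  simpa only [Set.image_subset_image_iff Subtype.val_injective] using this

/-- Krull dimension of a closed set equals that of its coordinate ring. -/
theorem vdim_eq [IsAlgClosed K] {V : Set (Fin n → K)} (hV : IsClosed V) :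
    vdim K n V = ringKrullDim (MvPolynomial (Fin n) K ⧸ _root_.vanishingIdeal K n V) := by
  have hcl : ∀ Z : TopologicalSpace.IrreducibleCloseds V, IsClosed (Subtype.val '' (Z : Set V)) :=
    fun Z => hV.isClosedEmbedding_subtypeVal.isClosedMap _ Z.isClosed'
  have hirr : ∀ Z : TopologicalSpace.IrreducibleCloseds V,
      IsIrreducible (Subtype.val '' (Z : Set V)) :=
    fun Z => Z.isIrreducible'.image _ continuous_subtype_val.continuousOn
  rw [ringKrullDim_quotient, vdim, topologicalKrullDim, ← Order.krullDim_orderDual]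
  apply le_antisymm
  · refine Order.krullDim_le_of_strictMono (fun Z => ⟨⟨_root_.vanishingIdeal K n
      (Subtype.val '' ((OrderDual.ofDual Z : TopologicalSpace.IrreducibleCloseds V) : Set V)),
      prime_of_irr (hirr _)⟩, ?_⟩) ?_
    · intro f hf x hx
      obtain ⟨y, _, rfl⟩ := hx
      exact hf y y.2
    · apply Monotone.strictMono_of_injective
      · intro Z Z' h f hf x hx
        exact hf x (Set.image_mono (show ((OrderDual.ofDual Z' : TopologicalSpace.IrreducibleCloseds V) : Set V) ⊆
          (OrderDual.ofDual Z : TopologicalSpace.IrreducibleCloseds V) from h) hx)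
      · intro Z Z' h
        have h' := congrArg (fun P => P.1.asIdeal) h
        simp only at h'
        have h2 := closed_eq (hcl (OrderDual.ofDual Z))
        rw [h', closed_eq (hcl (OrderDual.ofDual Z'))] at h2
        have := Set.image_injective.2 Subtype.val_injective h2
        exact (congrArg OrderDual.toDual (SetLike.coe_injective this)).symm
  · have key : ∀ P : PrimeSpectrum.zeroLocus (R := MvPolynomial (Fin n) K)
        (_root_.vanishingIdeal K n V),
        _root_.zeroLocus K n P.1.asIdeal ⊆ V := by
      intro P x hx
      rw [← closed_eq hV]
      exact fun f hf => hx f (P.2 hf)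
    have himg : ∀ P : PrimeSpectrum.zeroLocus (R := MvPolynomial (Fin n) K)
        (_root_.vanishingIdeal K n V),
        Subtype.val '' (Subtype.val ⁻¹' _root_.zeroLocus K n P.1.asIdeal : Set V) =
          _root_.zeroLocus K n P.1.asIdeal := by
      intro P
      rw [Subtype.image_preimage_coe, Set.inter_eq_right.2 (key P)]
    refine Order.krullDim_le_of_strictMono (fun P => OrderDual.toDual
      ⟨Subtype.val ⁻¹' _root_.zeroLocus K n P.1.asIdeal, ?_, ?_⟩) ?_
    · apply irr_of_image hV
      rw [himg P]
      apply irr_of_prime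
      rw [vI_zL_prime]
      exact P.1.isPrime
    · exact (closed_zeroLocus _).preimage continuous_subtype_val
    · apply Monotone.strictMono_of_injective
      · intro P Q h
        refine OrderDual.toDual_le_toDual.2 (SetLike.coe_subset_coe.1 ?_)
        intro x hx f hf
        exact hx f (h hf)
      · intro P Q h
        have h1 : (Subtype.val ⁻¹' _root_.zeroLocus K n P.1.asIdeal : Set V) =
          Subtype.val ⁻¹' _root_.zeroLocus K n Q.1.asIdeal :=
          congrArg (fun Z => ((OrderDual.ofDual Z : TopologicalSpace.IrreducibleCloseds V) : Set V)) h
        have h2 := himg P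
        rw [h1, himg Q] at h2
        have h3 := vI_zL_prime P.1.asIdeal
        rw [← h2, vI_zL_prime] at h3
        exact Subtype.ext (PrimeSpectrum.ext h3.symm)

end Zar

section Alg

theorem dim_le_of_integral {R S : Type*} [CommRing R] [CommRing S] [IsDomain R] [IsDomain S]
    [Algebra R S]
    [Algebra.IsIntegral R S] (hinj : Function.Injective (algebraMap R S)) :
    ringKrullDim R ≤ ringKrullDim S := by
  unfold ringKrullDim Order.krullDim
  apply iSup_le
  intro l
  obtain ⟨P, -, hP, hPl⟩ := Ideal.exists_ideal_over_prime_of_isIntegral (S := S)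
    (RelSeries.head l).asIdeal (⊥ : Ideal S) (by
      rw [← RingHom.ker_eq_comap_bot, (RingHom.injective_iff_ker_eq_bot _).1 hinj]; exact bot_le)
  have : P.LiesOver (RelSeries.head l).asIdeal := ⟨hPl.symm⟩
  obtain ⟨L, hL, -⟩ := Ideal.exists_ltSeries_of_hasGoingUp l P
  rw [← hL]
  exact le_iSup (fun L : LTSeries (PrimeSpectrum S) => ((L.length : ℕ) : WithBot ℕ∞)) L

theorem exists_alg {K : Type*} [Field K] {n k : ℕ} (Q : Ideal (MvPolynomial (Fin n) K))
    [Q.IsPrime] (hdim : ringKrullDim (MvPolynomial (Fin n) K ⧸ Q) = (k : WithBot ℕ∞))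
    (s : Fin k → Fin n) (j : Fin n) :
    ∃ F : MvPolynomial (Option (Fin k)) K, F ≠ 0 ∧
      rename (fun o : Option (Fin k) => o.elim j s) F ∈ Q := by
  obtain ⟨m, g, hg, hint⟩ := exists_integral_inj_algHom_of_fg K (MvPolynomial (Fin n) K ⧸ Q)
  let _ : Algebra (MvPolynomial (Fin m) K) (MvPolynomial (Fin n) K ⧸ Q) := g.toRingHom.toAlgebra
  have : IsScalarTower K (MvPolynomial (Fin m) K) (MvPolynomial (Fin n) K ⧸ Q) :=
    IsScalarTower.of_algebraMap_eq' g.comp_algebraMap.symm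
  have : Algebra.IsIntegral (MvPolynomial (Fin m) K) (MvPolynomial (Fin n) K ⧸ Q) := ⟨hint⟩
  have : FaithfulSMul (MvPolynomial (Fin m) K) (MvPolynomial (Fin n) K ⧸ Q) :=
    (faithfulSMul_iff_algebraMap_injective _ _).2 hg
  have h1 := dim_le_of_integral (R := MvPolynomial (Fin m) K) (S := MvPolynomial (Fin n) K ⧸ Q) hg
  rw [hdim, MvPolynomial.ringKrullDim_of_isNoetherianRing, ringKrullDim_eq_zero_of_field] at h1
  have hmk : m ≤ k := by
    simp at h1
    exact_mod_cast h1
  have h2 := trdeg_add_eq K (S := MvPolynomial (Fin m) K) (A := MvPolynomial (Fin n) K ⧸ Q)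
  rw [MvPolynomial.trdeg_of_isDomain, trdeg_eq_zero] at h2
  by_contra hcon
  push Not at hcon
  have hind : AlgebraicIndependent K (fun o : Option (Fin k) =>
      Ideal.Quotient.mkₐ K Q (X (o.elim j s))) := by
    rw [algebraicIndependent_iff]
    intro p hp
    by_contra hp0
    apply hcon p hp0
    rw [← Ideal.Quotient.eq_zero_iff_mem, ← hp]
    have : (aeval fun o : Option (Fin k) => Ideal.Quotient.mkₐ K Q (X (o.elim j s))) =
      (Ideal.Quotient.mkₐ K Q).comp (rename (fun o : Option (Fin k) => o.elim j s)) := by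
      ext o; simp
    rw [this]; rfl
  have h3 := hind.lift_cardinalMk_le_trdeg
  rw [← h2] at h3
  simp at h3
  have : k + 1 ≤ m := by exact_mod_cast h3
  omega

/-- Any element outside a prime `Q`, modulo which everything is algebraic over the
polynomials in `κ`, has a nonzero multiple (mod `Q`) in these polynomials. -/
theorem elim {K : Type*} [Field K] {κ τ : Type*} (s : κ → τ) (Q : Ideal (MvPolynomial τ K))
    [hQ : Q.IsPrime]
    (halg : ∀ j, ∃ F : MvPolynomial (Option κ) K, F ≠ 0 ∧
      rename (fun o : Option κ => o.elim j s) F ∈ Q)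
    (g : MvPolynomial τ K) (hg : g ∉ Q) :
    ∃ c : MvPolynomial κ K, c ≠ 0 ∧ ∃ b, rename s c - b * g ∈ Q := by
  let φ : MvPolynomial κ K →+* (MvPolynomial τ K ⧸ Q) :=
    (Ideal.Quotient.mk Q).comp (rename s).toRingHom
  let _ : Algebra (MvPolynomial κ K) (MvPolynomial τ K ⧸ Q) := φ.toAlgebra
  have hφ : ∀ c, algebraMap (MvPolynomial κ K) (MvPolynomial τ K ⧸ Q) c =
    Ideal.Quotient.mk Q (rename s c) := fun c => rfl
  have hX : ∀ j, IsAlgebraic (MvPolynomial κ K) (Ideal.Quotient.mk Q (X j)) := by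
    intro j
    obtain ⟨F, hF, hFQ⟩ := halg j
    refine ⟨optionEquivLeft K κ F, ?_, ?_⟩
    · simpa using hF
    · rw [← Ideal.Quotient.eq_zero_iff_mem] at hFQ
      have : ((Polynomial.aeval (R := MvPolynomial κ K)
          (Ideal.Quotient.mk Q (X j))).toRingHom.comp
            (optionEquivLeft K κ).toRingEquiv.toRingHom) = (Ideal.Quotient.mk Q).comp
              (rename (R := K) (fun o : Option κ => o.elim j s)).toRingHom := ?_
      · rw [← hFQ]
        exact congrArg (fun ψ : _ →+* _ => ψ F) this
      apply MvPolynomial.ringHom_ext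
      · intro r
        simp [optionEquivLeft_C, hφ]
      · intro o
        cases o with
        | none => simp [optionEquivLeft_X_none]
        | some a => simp [optionEquivLeft_X_some, hφ]
  have hall : ∀ p : MvPolynomial τ K, IsAlgebraic (MvPolynomial κ K) (Ideal.Quotient.mk Q p) := by
    intro p
    induction p using MvPolynomial.induction_on with
    | C a =>
      have := isAlgebraic_algebraMap (R := MvPolynomial κ K) (A := MvPolynomial τ K ⧸ Q) (C a)
      rwa [hφ, rename_C] at this
    | add p q hp hq => rw [map_add]; exact hp.add hq
    | mul_X p j hp => rw [map_mul]; exact hp.mul (hX j)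
  have h := Ideal.comap_ne_bot_of_algebraic_mem (R := MvPolynomial κ K)
    (I := Ideal.span {Ideal.Quotient.mk Q g}) (x := Ideal.Quotient.mk Q g)
    (by rwa [Ne, Ideal.Quotient.eq_zero_iff_mem]) (Ideal.mem_span_singleton_self _) (hall g)
  obtain ⟨c, hc, hc0⟩ := Submodule.exists_mem_ne_zero_of_ne_bot h
  refine ⟨c, hc0, ?_⟩
  rw [Ideal.mem_comap, Ideal.mem_span_singleton'] at hc
  obtain ⟨b, hb⟩ := hc
  obtain ⟨b, rfl⟩ := Ideal.Quotient.mk_surjective b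
  refine ⟨b, ?_⟩
  rw [← Ideal.Quotient.eq_zero_iff_mem, map_sub, map_mul, hb, hφ, sub_self]

end Alg

theorem exists_pderiv {K σ : Type*} [Field K] [IsAlgClosed K] {f : MvPolynomial σ K}
    (hf : Irreducible f) : ∃ i, pderiv i f ≠ 0 := by
  classical
  by_contra! h
  have h1 : ∀ m ∈ f.support, ∀ i, ((m i : ℕ) : K) = 0 := by
    intro m hm i
    by_cases hmi : m i = 0
    · simp [hmi]
    · have h2 := congrArg (coeff (m - Finsupp.single i 1)) (h i)
      rw [coeff_pderiv, coeff_zero, tsub_add_cancel_of_le] at h2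
      · rcases mul_eq_zero.1 h2 with h3 | h3
        · exact absurd h3 (mem_support_iff.1 hm)
        · have : m i = (m i - 1) + 1 := by omega
          rw [this]; push_cast
          simpa using h3
      · rw [Finsupp.single_le_iff]; omega
  rcases CharP.exists K with ⟨p, hp⟩
  rcases CharP.char_is_prime_or_zero K p with hpp | hp0
  · have : Fact p.Prime := ⟨hpp⟩
    have h2 : ∀ m ∈ f.support, ∀ i, p ∣ m i := fun m hm i =>
      (CharP.cast_eq_zero_iff K p _).1 (h1 m hm i)
    have h3 : ∀ c : K, ∃ r : K, r ^ p = c := fun c => IsAlgClosed.exists_pow_nat_eq c hpp.pos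
    choose r hr using h3
    have h4 : f = (∑ m ∈ f.support,
        monomial (m.mapRange (fun a => a / p) (by simp)) (r (coeff m f))) ^ p := by
      rw [sum_pow_char]
      conv_lhs => rw [f.as_sum]
      apply Finset.sum_congr rfl
      intro m hm
      rw [monomial_pow, hr]
      have : m = p • m.mapRange (fun a => a / p) (by simp) := by
        ext i
        simp [Nat.mul_div_cancel' (h2 m hm i)]
      rw [← this]
    rw [h4] at hf
    exact not_irreducible_pow hpp.ne_one hf
  · subst hp0
    have : CharZero K := CharP.charP_to_charZero K
    have h2 : f = C (coeff 0 f) := by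
      ext m
      rw [coeff_C]
      split_ifs with hm
      · rw [hm]
      · by_contra hc
        apply hm
        ext i
        have := h1 m (mem_support_iff.2 hc) i
        rw [Nat.cast_eq_zero] at this
        simpa using this.symm
    apply hf.not_isUnit
    rw [h2]
    apply IsUnit.map
    rw [isUnit_iff_ne_zero]
    intro h3
    rw [h3] at h2
    exact hf.ne_zero (by simpa using h2)

theorem homComp_ne {K σ : Type*} [Field K] {f : MvPolynomial σ K} (hf : f ≠ 0) :
    homogeneousComponent f.totalDegree f ≠ 0 := by
  obtain ⟨m, hm, hmax⟩ := Finset.exists_mem_eq_sup f.support (support_nonempty.2 hf)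
    (fun m => m.sum fun _ e => e)
  intro h
  have := congrArg (coeff m) h
  rw [coeff_homogeneousComponent, if_pos] at this
  · exact (mem_support_iff.1 hm) (by simpa using this)
  · exact hmax.symm

theorem exists_dir {K σ : Type*} [Field K] [IsAlgClosed K] [Fintype σ] {f : MvPolynomial σ K}
    (hf : Irreducible f) (o : σ) : ∃ w : σ → K, w o ≠ 0 ∧
      eval w (homogeneousComponent f.totalDegree f) ≠ 0 ∧ ∑ i, C (w i) * pderiv i f ≠ 0 := by
  obtain ⟨i, hi⟩ := exists_pderiv hf
  have : Infinite K := IsAlgClosed.instInfinite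
  have key : ∀ p : MvPolynomial σ K, p ≠ 0 → ∃ z, eval z p ≠ 0 := by
    intro p hp
    by_contra! h
    exact hp (MvPolynomial.funext (fun x => by simpa using h x))
  obtain ⟨z, hz⟩ := key _ hi
  have hL : (∑ j, C (eval z (pderiv j f)) * X j : MvPolynomial σ K) ≠ 0 := by
    classical
    intro h
    have := congrArg (eval (Pi.single i 1)) h
    simp [Pi.single_apply] at this
    exact hz this
  obtain ⟨w, hw⟩ := key _ (mul_ne_zero (mul_ne_zero (X_ne_zero o) (homComp_ne hf.ne_zero)) hL)
  simp only [map_mul, ne_eq, mul_eq_zero, not_or, eval_X] at hw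
  refine ⟨w, hw.1.1, hw.1.2, fun h => hw.2 ?_⟩
  have := congrArg (eval z) h
  simp only [map_sum, map_mul, eval_C, map_zero, eval_X] at this ⊢
  rw [← this]
  exact Finset.sum_congr rfl fun _ _ => mul_comm _ _

theorem lin_prod {K σ : Type*} [Field K] (q w : σ → K) (m : σ → ℕ) (s : Finset σ) :
    (∏ o ∈ s, (Polynomial.C (q o) + Polynomial.C (w o) * Polynomial.X) ^ m o).natDegree
        ≤ ∑ o ∈ s, m o ∧
    (∏ o ∈ s, (Polynomial.C (q o) + Polynomial.C (w o) * Polynomial.X) ^ m o).coeff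
      (∑ o ∈ s, m o) = ∏ o ∈ s, w o ^ m o := by
  classical
  induction s using Finset.induction_on with
  | empty => simp
  | insert a s ha ih =>
    have h1 : (Polynomial.C (q a) + Polynomial.C (w a) * Polynomial.X).natDegree ≤ 1 := by
      rw [add_comm]; exact Polynomial.natDegree_linear_le
    have h2 : ((Polynomial.C (q a) + Polynomial.C (w a) * Polynomial.X) ^ m a).natDegree ≤ m a := by
      simpa using Polynomial.natDegree_pow_le_of_le (m a) h1
    have h3 : ((Polynomial.C (q a) + Polynomial.C (w a) * Polynomial.X) ^ m a).coeff (m a)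
        = w a ^ m a := by
      have := Polynomial.coeff_pow_of_natDegree_le (m := m a) h1
      simpa [Polynomial.coeff_C] using this
    rw [Finset.prod_insert ha, Finset.sum_insert ha, Finset.prod_insert ha]
    refine ⟨Polynomial.natDegree_mul_le_of_le h2 ih.1, ?_⟩
    rw [Polynomial.coeff_mul_add_eq_of_natDegree_le h2 ih.1, h3, ih.2]

theorem lin_deg {K σ : Type*} [Field K] [Fintype σ] (q w : σ → K) (f : MvPolynomial σ K)
    (h : eval w (homogeneousComponent f.totalDegree f) ≠ 0) :
    (aeval (fun o => Polynomial.C (q o) + Polynomial.C (w o) * Polynomial.X) f).natDegree =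
      f.totalDegree := by
  have hdeg : ∀ m : σ →₀ ℕ, (m.sum fun _ e => e) = ∑ o, m o := fun m =>
    Finsupp.sum_fintype _ _ (fun _ => rfl)
  have hdeg' : ∀ m : σ →₀ ℕ, m.degree = ∑ o, m o := fun m => Finsupp.degree_eq_sum m
  have hsum : aeval (fun o => Polynomial.C (q o) + Polynomial.C (w o) * Polynomial.X) f =
      ∑ m ∈ f.support, Polynomial.C (coeff m f) *
        ∏ o, (Polynomial.C (q o) + Polynomial.C (w o) * Polynomial.X) ^ m o := by
    rw [aeval_eq_eval₂Hom, coe_eval₂Hom, eval₂_eq']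
    rfl
  have hle : ∀ m ∈ f.support, ∑ o, m o ≤ f.totalDegree := fun m hm => by
    rw [← hdeg]; exact le_totalDegree hm
  apply le_antisymm
  · rw [hsum]
    apply Polynomial.natDegree_sum_le_of_forall_le
    intro m hm
    exact (Polynomial.natDegree_C_mul_le _ _).trans ((lin_prod q w m Finset.univ).1.trans (hle m hm))
  · apply Polynomial.le_natDegree_of_ne_zero
    convert h using 1
    rw [hsum, Polynomial.finsetSum_coeff, homogeneousComponent_apply, map_sum, Finset.sum_filter]
    apply Finset.sum_congr rfl
    intro m hm
    rw [Polynomial.coeff_C_mul, hdeg']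
    split_ifs with h1
    · rw [← h1, (lin_prod q w m Finset.univ).2, eval_monomial, Finsupp.prod_fintype _ _ (by simp)]
    · rw [Polynomial.coeff_eq_zero_of_natDegree_lt, mul_zero]
      exact lt_of_le_of_lt (lin_prod q w m Finset.univ).1 (lt_of_le_of_ne (hle m hm) h1)

/-- the shear -/
noncomputable def shear {K κ : Type*} [Field K] (w : Option κ → K) :
    MvPolynomial (Option κ) K →ₐ[K] MvPolynomial (Option κ) K :=
  aeval (fun o => o.elim (C (w none) * X none) (fun i => X (some i) + C (w (some i)) * X none))

theorem shear_bij {K κ : Type*} [Field K] (w : Option κ → K) (h0 : w none ≠ 0) :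
    ∃ θ : MvPolynomial (Option κ) K ≃ₐ[K] MvPolynomial (Option κ) K, ∀ p, θ p = shear w p := by
  have hC : (C (w none)⁻¹ : MvPolynomial (Option κ) K) * C (w none) = 1 := by
    rw [← C_mul, inv_mul_cancel₀ h0, C_1]
  refine ⟨AlgEquiv.ofAlgHom (shear w) (aeval (fun o => o.elim (C (w none)⁻¹ * X none)
    (fun i => X (some i) - C (w (some i) * (w none)⁻¹) * X none))) ?_ ?_, fun p => rfl⟩
  · apply MvPolynomial.algHom_ext
    rintro (_ | i)
    · simp [shear]
      linear_combination (X none) * hC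
    · simp [shear]
      linear_combination (- C (w (some i)) * X none) * hC
  · apply MvPolynomial.algHom_ext
    rintro (_ | i)
    · simp [shear]
      linear_combination (X none) * hC
    · simp [shear]
      ring

theorem shear_pderiv {K κ : Type*} [Field K] [Fintype κ] (w : Option κ → K)
    (p : MvPolynomial (Option κ) K) :
    pderiv none (shear w p) = shear w (∑ i, C (w i) * pderiv i p) := by
  classical
  induction p using MvPolynomial.induction_on with
  | C a => simp [shear]
  | add p q hp hq =>
    simp only [map_add, hp, hq, mul_add, Finset.sum_add_distrib]
  | mul_X p o hp =>
    have hX : pderiv none (shear w (X o)) = C (w o) := by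
      rcases o with _ | i
      · simp [shear]
      · simp [shear, pderiv_X]
    rw [map_mul, Derivation.leibniz, hp, hX]
    simp only [Derivation.leibniz, pderiv_X, smul_eq_mul, mul_add, Finset.sum_add_distrib, map_add]
    have e1 : ∑ i, C (w i) * (p * (Pi.single i 1 : Option κ → MvPolynomial (Option κ) K) o)
        = C (w o) * p := by
      rw [Finset.sum_eq_single o]
      · simp
      · intro b _ hb; simp [Pi.single_eq_of_ne hb.symm]
      · simp
    rw [e1, map_mul, algHom_C, algebraMap_eq]
    have e2 : ∑ i, C (w i) * (X o * pderiv i p) = X o * ∑ i, C (w i) * pderiv i p := by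
      rw [Finset.mul_sum]
      exact Finset.sum_congr rfl fun _ _ => by ring
    rw [e2, map_mul]
    ring

theorem not_dvd_pderiv {K σ : Type*} [Field K] {g : MvPolynomial σ K} {i : σ}
    (h : pderiv i g ≠ 0) : ¬ g ∣ pderiv i g := by
  classical
  rintro ⟨c, hc⟩
  have hc0 : c ≠ 0 := by rintro rfl; simp [hc] at h
  have hg0 : g ≠ 0 := by rintro rfl; simp at h
  have h1 : (pderiv i g).totalDegree < g.totalDegree := by
    have hpos : ∀ m ∈ (pderiv i g).support, (m.sum fun _ e => e) + 1 ≤ g.totalDegree := by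
      intro m hm
      rw [mem_support_iff, coeff_pderiv] at hm
      have := le_totalDegree (mem_support_iff.2 (left_ne_zero_of_mul hm))
      rwa [Finsupp.sum_add_index' (by simp) (by simp), Finsupp.sum_single_index rfl] at this
    obtain ⟨m, hm⟩ := support_nonempty.2 h
    rw [totalDegree, Finset.sup_lt_iff]
    · intro m hm; exact hpos m hm
    · exact lt_of_lt_of_le (Nat.succ_pos _) (hpos m hm)
  rw [hc, totalDegree_mul_of_isDomain hg0 hc0] at h1
  omega

theorem generic_line {K : Type*} [Field K] [IsAlgClosed K] {k : ℕ}
    {f : MvPolynomial (Option (Fin k)) K} (hf : Irreducible f)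
    (hind : ∀ c : MvPolynomial (Fin k) K, c ≠ 0 → ¬ f ∣ rename some c)
    (a : MvPolynomial (Fin k) K) (ha : a ≠ 0) :
    ∃ (q : Fin k → K) (w : Option (Fin k) → K) (T : Finset K), w none ≠ 0 ∧
      T.card = f.totalDegree ∧
      (∀ t, eval (fun o : Option (Fin k) =>
        o.elim (w none * t) (fun i => q i + w (some i) * t)) f = 0 → t ∈ T) ∧
      ∀ t ∈ T, eval (fun o : Option (Fin k) =>
        o.elim (w none * t) (fun i => q i + w (some i) * t)) f = 0 ∧
        eval (fun i => q i + w (some i) * t) a ≠ 0 := by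
  obtain ⟨w, hw0, hwe, hwD⟩ := exists_dir hf none
  obtain ⟨θ, hθ⟩ := shear_bij w hw0
  have hg : Irreducible (θ f) := (MulEquiv.irreducible_iff θ.toMulEquiv).2 hf
  have hgd : pderiv none (θ f) ≠ 0 := by
    rw [hθ, shear_pderiv, ← hθ]
    exact (map_ne_zero_iff θ θ.injective).2 hwD
  have hgp : Prime (θ f) := hg.prime
  have hdvd : ¬ θ f ∣ pderiv none (θ f) * θ (rename some a) := by
    intro h
    rcases hgp.dvd_or_dvd h with h | h
    · exact not_dvd_pderiv hgd h
    · exact hind a ha ((map_dvd_iff θ).1 h)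
  have hQ : (Ideal.span {θ f}).IsPrime := (Ideal.span_singleton_prime hg.ne_zero).2 hgp
  obtain ⟨c, hc, b, hb⟩ := elim some (Ideal.span {θ f}) (by
    rintro (_ | i)
    · refine ⟨θ f, hg.ne_zero, ?_⟩
      convert Ideal.mem_span_singleton_self (θ f)
      have : (fun o : Option (Fin k) => o.elim none some) = id := by
        funext o; rcases o with _ | i <;> rfl
      rw [this, rename_id_apply]
    · refine ⟨X none - X (some i), ?_, by simp⟩
      rw [sub_ne_zero]
      intro h
      simpa using X_injective h) _ (fun h => hdvd (Ideal.mem_span_singleton.1 h))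
  have : Infinite K := IsAlgClosed.instInfinite
  obtain ⟨q, hq⟩ : ∃ q, eval q c ≠ 0 := by
    by_contra! h
    exact hc (MvPolynomial.funext (fun x => by simpa using h x))
  let ρ : MvPolynomial (Option (Fin k)) K →ₐ[K] Polynomial K :=
    aeval (fun o : Option (Fin k) => o.elim Polynomial.X (fun i => Polynomial.C (q i)))
  have hρd : ∀ p, Polynomial.derivative (ρ p) = ρ (pderiv none p) := by
    intro p
    induction p using MvPolynomial.induction_on with
    | C a => simp [ρ]
    | add p q hp hq => simp only [map_add, hp, hq]
    | mul_X p o hp =>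
      rw [map_mul, Polynomial.derivative_mul, hp, Derivation.leibniz, map_add, smul_eq_mul,
        smul_eq_mul, map_mul, map_mul]
      rcases o with _ | i
      · simp [ρ]; ring
      · simp [ρ, pderiv_X]; ring
  have hρe : ∀ p, ρ (θ p) = aeval (fun o : Option (Fin k) =>
      Polynomial.C ((o.elim 0 q : K)) + Polynomial.C (w o) * Polynomial.X) p := by
    intro p
    have : ρ.comp (shear w) = aeval (fun o : Option (Fin k) =>
      Polynomial.C ((o.elim 0 q : K)) + Polynomial.C (w o) * Polynomial.X) := by
      apply MvPolynomial.algHom_ext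
      rintro (_ | i) <;> simp [ρ, shear]
    rw [← this, hθ]; rfl
  have hev : ∀ t p, Polynomial.eval t (ρ (θ p)) = eval (fun o : Option (Fin k) =>
        o.elim (w none * t) (fun i => q i + w (some i) * t)) p := by
    intro t p
    rw [hρe]
    have : ((Polynomial.aeval t).comp (aeval (fun o : Option (Fin k) =>
      Polynomial.C ((o.elim 0 q : K)) + Polynomial.C (w o) * Polynomial.X)) :
        MvPolynomial (Option (Fin k)) K →ₐ[K] K) = aeval (fun o : Option (Fin k) =>
        (o.elim (w none * t) (fun i => q i + w (some i) * t) : K)) := by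
      apply MvPolynomial.algHom_ext
      rintro (_ | i) <;> simp
    have := congrArg (fun ψ : _ →ₐ[K] _ => ψ p) this
    simpa [aeval_eq_eval, Polynomial.aeval_def] using this
  have hdeg := lin_deg (fun o : Option (Fin k) => (o.elim 0 q : K)) w f hwe
  rw [← hρe] at hdeg
  have hρc : ρ (rename some c) = Polynomial.C (eval q c) := by
    have : ρ.comp (rename some) = (Polynomial.CAlgHom.comp (aeval q) : MvPolynomial (Fin k) K →ₐ[K] _) := by
      apply MvPolynomial.algHom_ext
      intro i; simp [ρ]
    have := congrArg (fun ψ : _ →ₐ[K] _ => ψ c) this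
    simpa [aeval_eq_eval] using this
  have hbez : IsCoprime (ρ (θ f)) (ρ (pderiv none (θ f)) * ρ (θ (rename some a))) := by
    obtain ⟨u, hu⟩ := Ideal.mem_span_singleton.1 hb
    have := congrArg ρ hu
    rw [map_sub, hρc, map_mul, map_mul, map_mul] at this
    refine ⟨Polynomial.C (eval q c)⁻¹ * ρ u, Polynomial.C (eval q c)⁻¹ * ρ b, ?_⟩
    have hCC : Polynomial.C (eval q c)⁻¹ * Polynomial.C (eval q c) = 1 := by
      rw [← Polynomial.C_mul, inv_mul_cancel₀ hq, Polynomial.C_1]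
    linear_combination hCC - Polynomial.C (eval q c)⁻¹ * this
  have hsep : (ρ (θ f)).Separable := by
    rw [Polynomial.separable_def, hρd]
    exact hbez.of_mul_right_left
  have hcop := hbez.of_mul_right_right
  classical
  refine ⟨q, w, (ρ (θ f)).roots.toFinset, hw0, ?_, ?_, ?_⟩
  · rw [Multiset.toFinset_card_of_nodup (Polynomial.nodup_roots hsep), ← hdeg]
    exact IsAlgClosed.card_roots_eq_natDegree
  · intro t ht
    rw [Multiset.mem_toFinset, Polynomial.mem_roots hsep.ne_zero, Polynomial.IsRoot.def, hev, ht]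
  · intro t ht
    rw [Multiset.mem_toFinset, Polynomial.mem_roots hsep.ne_zero, Polynomial.IsRoot.def] at ht
    refine ⟨by rw [← hev, ht], fun h => ?_⟩
    obtain ⟨u, v, huv⟩ := hcop
    have h2 := congrArg (Polynomial.eval t) huv
    rw [Polynomial.eval_add, Polynomial.eval_mul, Polynomial.eval_mul, ht, hev, eval_rename] at h2
    have h3 : eval ((fun o : Option (Fin k) =>
        (o.elim (w none * t) (fun i => q i + w (some i) * t) : K)) ∘ some) a = 0 := h
    rw [h3] at h2
    simp at h2

theorem lift_point {K : Type*} [Field K] [IsAlgClosed K] {n k : ℕ}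
    (P : Ideal (MvPolynomial (Fin n) K)) [P.IsPrime]
    (idx : Option (Fin k) → Fin n) (F : Fin n → MvPolynomial (Option (Fin k)) K)
    (hF : ∀ j, rename (fun o : Option (Fin k) => o.elim j (fun i => idx (some i))) (F j) ∈ P)
    (y : Option (Fin k) → K) (hJ : ∀ p, rename idx p ∈ P → eval y p = 0)
    (hlc : ∀ j, eval (fun i => y (some i)) (optionEquivLeft K (Fin k) (F j)).leadingCoeff ≠ 0) :
    ∃ x ∈ _root_.zeroLocus K n P, ∀ o, x (idx o) = y o := by
  let M := MvPolynomial (Option (Fin k)) K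
  let B := MvPolynomial (Fin n) K ⧸ P
  let φ : M →+* B := (Ideal.Quotient.mk P).comp (rename idx : M →ₐ[K] _).toRingHom
  have hφC : ∀ r : K, φ (C r) = Ideal.Quotient.mk P (C r) := fun r =>
    congrArg (Ideal.Quotient.mk P) (rename_C idx r)
  have hφX : ∀ o, φ (X o) = Ideal.Quotient.mk P (X (idx o)) := fun o =>
    congrArg (Ideal.Quotient.mk P) (rename_X idx o)
  let S : Submonoid M := (nonZeroDivisors K).comap (eval y)
  have hS : ∀ p : M, p ∈ S ↔ eval y p ≠ 0 := fun p => by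
    simp [S]
  let Cc := Localization S
  let D := Localization (S.map φ)
  let ψ : Cc →+* D := IsLocalization.map D φ (Submonoid.le_comap_map S)
  have hψ : ∀ p : M, ψ (algebraMap M Cc p) = algebraMap B D (φ p) := fun p =>
    IsLocalization.map_eq _ _
  let ev : Cc →+* K := IsLocalization.lift (M := S) (g := (eval y : M →+* K))
    (fun s => isUnit_iff_ne_zero.2 ((hS _).1 s.2))
  have hev : ∀ p : M, ev (algebraMap M Cc p) = eval y p := fun p => IsLocalization.lift_eq _ _
  have hker : RingHom.ker ψ ≤ RingHom.ker ev := by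
    intro z hz
    obtain ⟨p, s, rfl⟩ := IsLocalization.exists_mk'_eq S z
    rw [RingHom.mem_ker, IsLocalization.map_mk', IsLocalization.mk'_eq_zero_iff] at hz
    obtain ⟨⟨_, t, ht, rfl⟩, hc⟩ := hz
    have h1 : φ (t * p) = 0 := by rw [map_mul]; exact hc
    have h2 : eval y (t * p) = 0 := hJ _ (Ideal.Quotient.eq_zero_iff_mem.1 h1)
    rw [map_mul] at h2
    have h3 : eval y p = 0 := (mul_eq_zero.1 h2).resolve_left ((hS t).1 ht)
    rw [RingHom.mem_ker, IsLocalization.lift_mk', h3, zero_mul]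
  have hunit : ∀ c : MvPolynomial (Fin k) K, eval (fun i => y (some i)) c ≠ 0 →
      IsUnit (algebraMap M Cc (rename some c)) := by
    intro c hc
    apply IsLocalization.map_units Cc (⟨rename some c, ?_⟩ : S)
    rw [hS, eval_rename]
    exact hc
  let χ : MvPolynomial (Fin k) K →+* Cc := (algebraMap M Cc).comp (rename some : _ →ₐ[K] M).toRingHom
  have hX : ∀ j, ψ.IsIntegralElem (algebraMap B D (Ideal.Quotient.mk P (X j))) := by
    intro j
    let x := algebraMap B D (Ideal.Quotient.mk P (X j))
    have h0 : (optionEquivLeft K (Fin k) (F j)).eval₂ (ψ.comp χ) x = 0 := by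
      have hh : ((Polynomial.eval₂RingHom (ψ.comp χ) x).comp
          (optionEquivLeft K (Fin k)).toAlgHom.toRingHom) =
          ((algebraMap B D).comp ((Ideal.Quotient.mk P).comp
           (rename (fun o : Option (Fin k) => o.elim j (fun i => idx (some i))) :
            M →ₐ[K] _).toRingHom)) := by
        apply MvPolynomial.ringHom_ext
        · intro r
          simp [χ, hψ, hφC]
        · rintro (_ | i)
          · simp [x]
          · simp [χ, hψ, hφX]
      have := congrArg (fun ψ : _ →+* _ => ψ (F j)) hh
      refine Eq.trans ?_ (this.trans ?_)
      · rfl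
      · have h5 : Ideal.Quotient.mk P (rename (fun o : Option (Fin k) => o.elim j (fun i => idx (some i)))
          (F j)) = 0 := Ideal.Quotient.eq_zero_iff_mem.2 (hF j)
        exact (congrArg (algebraMap B D) h5).trans (map_zero _)
    have h1 := RingHom.isIntegralElem_leadingCoeff_mul (ψ.comp χ) _ x h0
    have h2 : ψ.IsIntegralElem ((ψ.comp χ) (optionEquivLeft K (Fin k) (F j)).leadingCoeff * x) := by
      obtain ⟨p, hp, hp0⟩ := h1
      refine ⟨p.map χ, hp.map _, ?_⟩
      rw [Polynomial.eval₂_map]; exact hp0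
    obtain ⟨u, hu⟩ := (hunit _ (hlc j)).exists_left_inv
    have h3 := RingHom.IsIntegralElem.mul ψ (ψ.isIntegralElem_map (x := u)) h2
    have : u * χ (optionEquivLeft K (Fin k) (F j)).leadingCoeff = 1 := hu
    rw [← mul_assoc, RingHom.comp_apply, ← map_mul, this, map_one, one_mul] at h3
    exact h3
  have hint0 : ∀ p : MvPolynomial (Fin n) K,
      ψ.IsIntegralElem (algebraMap B D (Ideal.Quotient.mk P p)) := by
    intro p
    induction p using MvPolynomial.induction_on with
    | C a =>
      have : algebraMap B D (Ideal.Quotient.mk P (C a)) = ψ (algebraMap M Cc (C a)) := by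
        rw [hψ, hφC]
      rw [this]
      exact ψ.isIntegralElem_map
    | add p q hp hq =>
      rw [map_add, map_add]
      exact RingHom.IsIntegralElem.add ψ hp hq
    | mul_X p j hp =>
      rw [map_mul, map_mul]
      exact RingHom.IsIntegralElem.mul ψ hp (hX j)
  have hint : ψ.IsIntegral := by
    intro z
    obtain ⟨b, ⟨_, s, hs, rfl⟩, rfl⟩ := IsLocalization.exists_mk'_eq (S.map φ) z
    obtain ⟨p, rfl⟩ := Ideal.Quotient.mk_surjective b
    have : IsLocalization.mk' D (Ideal.Quotient.mk P p) (⟨φ s, s, hs, rfl⟩ : S.map φ) =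
       algebraMap B D (Ideal.Quotient.mk P p) * ψ (IsLocalization.mk' Cc 1 ⟨s, hs⟩) := by
      rw [IsLocalization.map_mk', map_one, ← IsLocalization.mk'_one (M := S.map φ) D, 
        ← IsLocalization.mk'_mul]
      simp
    rw [this]
    exact RingHom.IsIntegralElem.mul ψ (hint0 p) ψ.isIntegralElem_map
  let _ : Algebra Cc D := ψ.toAlgebra
  have : Algebra.IsIntegral Cc D := ⟨hint⟩
  have hprime : (RingHom.ker ev).IsPrime := RingHom.ker_isPrime ev
  obtain ⟨Q, -, hQp, hQ⟩ := Ideal.exists_ideal_over_prime_of_isIntegral (S := D) (RingHom.ker ev) ⊥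
    hker
  let η : MvPolynomial (Fin n) K →+* D := (algebraMap B D).comp (Ideal.Quotient.mk P)
  have hQ' : (Q.comap η).IsPrime := Ideal.IsPrime.comap η
  have hne : (_root_.zeroLocus K n (Q.comap η)).Nonempty := by
    by_contra h
    rw [Set.not_nonempty_iff_eq_empty] at h
    have h1 := vI_zL_prime (Q.comap η)
    rw [h] at h1
    apply hQ'.ne_top
    rw [← h1, Ideal.eq_top_iff_one]
    intro x hx
    exact absurd hx (Set.notMem_empty x)
  obtain ⟨x, hx⟩ := hne
  refine ⟨x, fun g hg => hx g ?_, fun o => ?_⟩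
  · change η g ∈ Q
    have : Ideal.Quotient.mk P g = 0 := Ideal.Quotient.eq_zero_iff_mem.2 hg
    simp [η, this]
  · have h1 : algebraMap M Cc (X o - C (y o)) ∈ RingHom.ker ev := by
      rw [RingHom.mem_ker, hev]; simp
    rw [← hQ] at h1
    have h2 : ψ (algebraMap M Cc (X o - C (y o))) ∈ Q := h1
    rw [hψ] at h2
    have h3 := hx (X (idx o) - C (y o)) (by
      change η _ ∈ Q
      simpa [η, hφC, hφX] using h2)
    simpa [sub_eq_zero] using h3

/-- linear substitution -/
noncomputable def linPt {A : Type*} [CommRing A] {n k : ℕ} (q v : Fin k → A)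
    (j0 : {j : Fin n // ¬ (j : ℕ) < k})
    (z : {j : Fin n // ¬ (j : ℕ) < k} → A) : Fin n → A :=
  fun j => if h : (j : ℕ) < k then q ⟨j, h⟩ + v ⟨j, h⟩ * z j0 else z ⟨j, h⟩

theorem subspace {K : Type*} [Field K] [IsAlgClosed K] {n k : ℕ} (hkn : k ≤ n)
    (q v : Fin k → K) (j0 : {j : Fin n // ¬ (j : ℕ) < k}) :
    IsAffineSubspace K n {x | ∀ i, x (Fin.castLE hkn i) = q i + v i * x j0} ∧
    vdim K n {x | ∀ i, x (Fin.castLE hkn i) = q i + v i * x j0} = ((n - k : ℕ) : WithBot ℕ∞) := by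
  have hA : IsAffineSubspace K n {x | ∀ i, x (Fin.castLE hkn i) = q i + v i * x j0} := by
    refine ⟨Set.range (fun i => X (Fin.castLE hkn i) - (C (q i) + C (v i) * X j0.1)), ?_, ?_⟩
    · rintro _ ⟨i, rfl⟩
      refine (totalDegree_sub _ _).trans (max_le (totalDegree_X _).le ?_)
      refine (totalDegree_add _ _).trans (max_le (by simp) ?_)
      refine (totalDegree_mul _ _).trans ?_
      simp
    · ext x
      simp [_root_.zeroLocus, sub_eq_zero]
  refine ⟨hA, ?_⟩
  set L : Set (Fin n → K) := {x | ∀ i, x (Fin.castLE hkn i) = q i + v i * x j0} with hL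
  have hmemL : ∀ x, x ∈ L ↔ ∃ z, x = linPt q v j0 z := by
    intro x
    constructor
    · intro hx
      refine ⟨fun j => x j, ?_⟩
      funext j
      unfold linPt
      split_ifs with h
      · exact hx ⟨j, h⟩
      · rfl
    · rintro ⟨z, rfl⟩ i
      have h1 : ((Fin.castLE hkn i : Fin n) : ℕ) < k := i.2
      simp only [linPt, h1, j0.2, dif_pos, dif_neg, not_false_eq_true]
      rfl
  have hcl : IsClosed L := by
    obtain ⟨S, -, hS⟩ := hA
    exact (isClosed_iff _).2 ⟨S, hS⟩
  let σ := {j : Fin n // ¬ (j : ℕ) < k}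
  let Φ : MvPolynomial (Fin n) K →ₐ[K] MvPolynomial σ K :=
    aeval (linPt (fun i => C (q i)) (fun i => C (v i)) j0 X)
  have hΦ : ∀ z p, eval z (Φ p) = eval (linPt q v j0 z) p := by
    intro z p
    have : (aeval z : MvPolynomial σ K →ₐ[K] K).comp Φ = aeval (linPt q v j0 z) := by
      apply MvPolynomial.algHom_ext
      intro j
      simp only [Φ, AlgHom.comp_apply, aeval_X, linPt]
      split_ifs <;> simp
    have := congrArg (fun ψ : _ →ₐ[K] _ => ψ p) this
    simpa [aeval_eq_eval] using this
  have : Infinite K := IsAlgClosed.instInfinite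
  have hker : RingHom.ker Φ = _root_.vanishingIdeal K n L := by
    ext p
    rw [RingHom.mem_ker, mem_vI]
    constructor
    · intro h x hx
      obtain ⟨z, rfl⟩ := (hmemL x).1 hx
      rw [← hΦ, h, map_zero]
    · intro h
      apply MvPolynomial.funext
      intro z
      rw [hΦ, map_zero]
      exact h _ ((hmemL _).2 ⟨z, rfl⟩)
  have hsurj : Function.Surjective Φ := by
    intro p
    refine ⟨rename Subtype.val p, ?_⟩
    have : Φ.comp (rename Subtype.val) = AlgHom.id K _ := by
      apply MvPolynomial.algHom_ext
      intro j
      simp [Φ, linPt, j.2]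
    exact congrArg (fun ψ : _ →ₐ[K] _ => ψ p) this
  rw [vdim_eq hcl, ← hker, ringKrullDim_eq_of_ringEquiv
    (Ideal.quotientKerAlgEquivOfSurjective hsurj).toRingEquiv,
    MvPolynomial.ringKrullDim_of_isNoetherianRing]
  rw [ringKrullDim_eq_zero_of_field, zero_add]
  congr 1
  rw [Nat.card_eq_fintype_card, Fintype.card_subtype_compl, Fintype.card_fin]
  have : Fintype.card {j : Fin n // (j : ℕ) < k} = k := by
    rw [Fintype.card_congr (Fin.castLEquiv hkn).symm, Fintype.card_fin]
  rw [this]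

theorem core {K : Type*} [Field K] [IsAlgClosed K] {n k d : ℕ} (hkn : k ≤ n)
    (V : Set (Fin n → K)) (hV : IsClosed V) (hirr : IsIrreducible V)
    (hVdim : vdim K n V = (k : WithBot ℕ∞)) (hVdeg : vdeg K n V = (d : ℕ∞))
    (hindep : ∀ c : MvPolynomial (Fin k) K, c ≠ 0 →
      rename (Fin.castLE hkn) c ∉ _root_.vanishingIdeal K n V)
    (j0 : Fin n) (hj0 : ¬ (j0 : ℕ) < k) :
    ∃ f : MvPolynomial (Option (Fin k)) K,
      rename (fun o : Option (Fin k) => o.elim j0 (Fin.castLE hkn)) f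
        ∈ _root_.vanishingIdeal K n V ∧ f ≠ 0 ∧ f.totalDegree ≤ d := by
  have hP := prime_of_irr hirr
  set P := _root_.vanishingIdeal K n V with hPdef
  have hdim := hVdim
  rw [vdim_eq hV] at hdim
  let idx : Option (Fin k) → Fin n := fun o => o.elim j0 (Fin.castLE hkn)
  let J : Ideal (MvPolynomial (Option (Fin k)) K) :=
    P.comap (rename idx : MvPolynomial (Option (Fin k)) K →ₐ[K] _)
  have hJ : J.IsPrime := Ideal.IsPrime.comap _
  have hmemJ : ∀ p, p ∈ J ↔ rename idx p ∈ P := fun p => Iff.rfl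
  choose F hF0 hF using exists_alg P hdim (Fin.castLE hkn)
  have hJ0 : J ≠ ⊥ := by
    intro h
    apply hF0 j0
    have : F j0 ∈ J := hF j0
    rw [h] at this
    simpa using this
  obtain ⟨f, hfJ, hfp⟩ := Ideal.IsPrime.exists_mem_prime_of_ne_bot hJ hJ0
  have hf : Irreducible f := hfp.irreducible
  have hsome : ∀ c : MvPolynomial (Fin k) K, c ≠ 0 → rename some c ∉ J := by
    intro c hc h
    rw [hmemJ, rename_rename] at h
    exact hindep c hc h
  have hind : ∀ c : MvPolynomial (Fin k) K, c ≠ 0 → ¬ f ∣ rename some c := fun c hc h =>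
    hsome c hc (J.mem_of_dvd h hfJ)
  have hJf : ∀ p ∈ J, f ∣ p := by
    intro p hp
    by_contra hdvd
    have hQ : (Ideal.span {f}).IsPrime := (Ideal.span_singleton_prime hf.ne_zero).2 hfp
    obtain ⟨c, hc, b, hb⟩ := elim some (Ideal.span {f}) (by
      rintro (_ | i)
      · refine ⟨f, hf.ne_zero, ?_⟩
        convert Ideal.mem_span_singleton_self f
        have : (fun o : Option (Fin k) => o.elim none some) = id := by
          funext o; rcases o with _ | i <;> rfl
        rw [this, rename_id_apply]
      · refine ⟨X none - X (some i), ?_, by simp⟩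
        rw [sub_ne_zero]
        intro h
        simpa using X_injective h) p (fun h => hdvd (Ideal.mem_span_singleton.1 h))
    apply hsome c hc
    have h1 : rename some c - b * p ∈ J := J.mem_of_dvd (Ideal.mem_span_singleton.1 hb) hfJ
    simpa using J.add_mem h1 (J.mul_mem_left b hp)
  let lc : Fin n → MvPolynomial (Fin k) K := fun j => (optionEquivLeft K (Fin k) (F j)).leadingCoeff
  have hlc : ∀ j, lc j ≠ 0 := fun j => by
    simpa [lc] using hF0 j
  obtain ⟨q, w, T, hw0, hT, hTm, hTf⟩ := generic_line hf hind (∏ j, lc j)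
    (Finset.prod_ne_zero_iff.2 fun j _ => hlc j)
  refine ⟨f, hfJ, hf.ne_zero, ?_⟩
  let v : Fin k → K := fun i => w (some i) / w none
  let L : Set (Fin n → K) := {x | ∀ i, x (Fin.castLE hkn i) = q i + v i * x j0}
  obtain ⟨hLa, hLd⟩ := subspace hkn q v ⟨j0, hj0⟩
  have hdimL : vdim K n V + vdim K n L = (n : WithBot ℕ∞) := by
    rw [hVdim]
    refine (congrArg _ hLd).trans ?_
    norm_cast
    omega
  have hlift : ∀ t ∈ T, ∃ x ∈ V ∩ L, x j0 = w none * t := by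
    intro t ht
    obtain ⟨h1, h2⟩ := hTf t ht
    rw [map_prod, Finset.prod_ne_zero_iff] at h2
    obtain ⟨x, hx, hxy⟩ := lift_point P idx F hF (fun o : Option (Fin k) =>
        o.elim (w none * t) (fun i => q i + w (some i) * t)) (by
        intro p hp
        obtain ⟨u, rfl⟩ := hJf p hp
        rw [map_mul, h1, zero_mul]) (fun j => h2 j (Finset.mem_univ _))
    rw [hPdef, closed_eq hV] at hx
    have h0 : x j0 = w none * t := hxy none
    refine ⟨x, ⟨hx, fun i => ?_⟩, h0⟩
    have := hxy (some i)
    rw [h0]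
    refine this.trans ?_
    simp only [v, Option.elim]
    field_simp
  have hVT : ∀ x ∈ V ∩ L, ∃ t ∈ T, x j0 = w none * t ∧
      ∀ i, x (Fin.castLE hkn i) = q i + w (some i) * t := by
    rintro x ⟨hxV, hxL⟩
    have e0 : x j0 = w none * (x j0 / w none) := by field_simp
    have e1 : ∀ i, x (Fin.castLE hkn i) = q i + w (some i) * (x j0 / w none) := by
      intro i
      rw [hxL i]
      simp only [v]
      ring
    refine ⟨x j0 / w none, hTm _ ?_, e0, e1⟩
    have h1 : eval x (rename idx f) = 0 := hfJ x hxV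
    rw [eval_rename] at h1
    rw [← h1]
    congr 2
    funext o
    rcases o with _ | i
    · exact e0.symm
    · exact (e1 i).symm
  have hfin : (V ∩ L).Finite := by
    let Fp : K → Fin n → Polynomial K := fun t j =>
      Polynomial.map (eval (fun i => q i + w (some i) * t)) (optionEquivLeft K (Fin k) (F j))
    have hFp : ∀ t ∈ T, ∀ j, Fp t j ≠ 0 := by
      intro t ht j h
      have h2 := (hTf t ht).2
      rw [map_prod, Finset.prod_ne_zero_iff] at h2
      apply h2 j (Finset.mem_univ _)
      have := congrArg (fun p => p.coeff (optionEquivLeft K (Fin k) (F j)).natDegree) h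
      rwa [Polynomial.coeff_map, Polynomial.coeff_zero] at this
    have hsub : V ∩ L ⊆ ⋃ t ∈ T, Set.pi Set.univ (fun j => {r | (Fp t j).IsRoot r}) := by
      intro x hx
      obtain ⟨t, ht, -, e1⟩ := hVT x hx
      simp only [Set.mem_iUnion]
      refine ⟨t, ht, fun j _ => ?_⟩
      have h1 : eval x (rename _ (F j)) = 0 := hF j x hx.1
      rw [eval_rename] at h1
      change Polynomial.eval (x j) (Fp t j) = 0
      simp only [Fp]
      rw [← optionEquivLeft_elim_eval]
      rw [← h1]
      congr 2
      funext o
      rcases o with _ | i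
      · rfl
      · exact (e1 i).symm
    refine Set.Finite.subset ?_ hsub
    refine Set.Finite.biUnion T.finite_toSet fun t ht => Set.Finite.pi fun j => ?_
    exact Polynomial.finite_setOfPred_isRoot (hFp t ht j)
  have hcard : T.card ≤ (V ∩ L).ncard := by
    have h1 : T.card ≤ ((fun x : Fin n → K => x j0 / w none) '' (V ∩ L)).ncard := by
      rw [← Set.ncard_coe_finset]
      apply Set.ncard_le_ncard _ (hfin.image _)
      intro t ht
      obtain ⟨x, hx, h0⟩ := hlift t ht
      refine ⟨x, hx, ?_⟩
      simp only [h0]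
      field_simp
    exact h1.trans (Set.ncard_image_le hfin)
  have hdeg1 : ((V ∩ L).ncard : ℕ∞) ≤ irrDegree K n V := by
    unfold irrDegree
    exact le_iSup_of_le L (le_iSup_of_le hLa (le_iSup_of_le hdimL (le_iSup_of_le hfin le_rfl)))
  have hdeg2 : irrDegree K n V ≤ vdeg K n V := by
    have hI : IrreducibleSpace V := by
      have := hirr
      exact isIrreducible_iff_irreducibleSpace.1 this
    have hmem : (Set.univ : Set V) ∈ irreducibleComponents V := by
      rw [irreducibleComponents_eq_singleton]; rfl
    unfold vdeg
    rw [tsum_eq_single (⟨Set.univ, hmem⟩ : irreducibleComponents V)]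
    · simp
    · rintro ⟨Z, hZ⟩ hne
      rw [irreducibleComponents_eq_singleton] at hZ
      exact absurd (Subtype.ext (Set.mem_singleton_iff.1 hZ)) hne
  rw [hVdeg] at hdeg2
  rw [← hT]
  exact hcard.trans (by exact_mod_cast hdeg1.trans hdeg2)

theorem descend {F K : Type*} [Field F] [Field K] [Algebra F K] {n : ℕ}
    (V : Set (Fin n → K)) (hF : DefinedOver F K n V)
    (g : MvPolynomial (Fin n) K) (hg : g ∈ _root_.vanishingIdeal K n V) (m : Fin n →₀ ℕ)
    (hm : m ∈ g.support) : ∃ g' : MvPolynomial (Fin n) F,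
      MvPolynomial.map (algebraMap F K) g' ∈ _root_.vanishingIdeal K n V ∧
      g'.support ⊆ g.support ∧ m ∈ g'.support := by
  obtain ⟨s, hs⟩ := hF
  have h0 : coeff m g ≠ 0 := mem_support_iff.1 hm
  obtain ⟨l, hl⟩ : ∃ l : Module.Dual F K, l (coeff m g) ≠ 0 := by
    by_contra! h
    exact h0 ((Module.forall_dual_apply_eq_zero_iff F _).1 h)
  have hex : ∀ p : MvPolynomial (Fin n) K, ∃ p' : MvPolynomial (Fin n) F,
      ∀ m, coeff m p' = l (coeff m p) := by
    intro p
    refine ⟨∑ m ∈ p.support, monomial m (l (coeff m p)), fun m => ?_⟩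
    rw [coeff_sum]
    simp only [coeff_monomial]
    rw [Finset.sum_ite_eq']
    split_ifs with h
    · rfl
    · rw [notMem_support_iff.1 h, map_zero]
  choose Λ hΛ using hex
  have hmain : ∀ x ∈ Ideal.span ((MvPolynomial.map (algebraMap F K)) '' (s : Set (MvPolynomial (Fin n) F))),
      ∀ a, Λ (a * x) ∈ Ideal.span (s : Set (MvPolynomial (Fin n) F)) := by
    intro x hx
    induction hx using Submodule.span_induction with
    | mem x hx =>
      obtain ⟨h, hh, rfl⟩ := hx
      intro a
      have : Λ (a * MvPolynomial.map (algebraMap F K) h) = Λ a * h := by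
        ext m
        rw [hΛ, coeff_mul, coeff_mul, map_sum]
        apply Finset.sum_congr rfl
        intro p _
        rw [coeff_map, hΛ, mul_comm, ← Algebra.smul_def, map_smul, smul_eq_mul, mul_comm]
      rw [this]
      exact Ideal.mul_mem_left _ _ (Ideal.subset_span hh)
    | zero =>
      intro a
      have : Λ (a * 0) = 0 := by ext m; rw [hΛ]; simp
      rw [this]; exact Ideal.zero_mem _
    | add x y _ _ hx hy =>
      intro a
      have : Λ (a * (x + y)) = Λ (a * x) + Λ (a * y) := by
        ext m; rw [coeff_add, hΛ, hΛ, hΛ, mul_add, coeff_add, map_add]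
      rw [this]
      exact Ideal.add_mem _ (hx a) (hy a)
    | smul b x _ hx =>
      intro a
      rw [smul_eq_mul, ← mul_assoc]
      exact hx _
  refine ⟨Λ g, ?_, ?_, ?_⟩
  · have h1 := hmain g (hs ▸ hg) 1
    rw [one_mul] at h1
    rw [hs, ← Ideal.map_span]
    exact Ideal.mem_map_of_mem _ h1
  · intro m' hm'
    rw [mem_support_iff] at hm' ⊢
    intro h
    rw [hΛ, h, map_zero] at hm'
    exact hm' rfl
  · rw [mem_support_iff, hΛ]
    exact hl

theorem idx_inj {n k : ℕ} (hkn : k ≤ n) (j0 : Fin n) (hj0 : ¬ (j0 : ℕ) < k) :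
    Function.Injective (fun o : Option (Fin k) => o.elim j0 (Fin.castLE hkn)) := by
  rintro (_ | a) (_ | b) h
  · rfl
  · have h' : j0 = Fin.castLE hkn b := h
    exact absurd (h' ▸ b.2) hj0
  · have h' : Fin.castLE hkn a = j0 := h
    exact absurd (h' ▸ a.2) hj0
  · have : Fin.castLE hkn a = Fin.castLE hkn b := h
    rw [Fin.castLE_injective hkn this]

end ICP

theorem irreducible_component_of_projections
    {F K : Type*} [Field F] [Field K] [IsAlgClosed K] [Algebra F K] [Algebra.IsAlgebraic F K]
    {n k d : ℕ} (hkn : k ≤ n)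
    (V : Set (Fin n → K)) (hV : IsAffineVariety K n V) (hirr : IsIrreducible V)
    (hF : DefinedOver F K n V)
    (hVdim : vdim K n V = (k : WithBot ℕ∞)) (hVdeg : vdeg K n V = (d : ℕ∞))
    (hindep : ∀ g : MvPolynomial (Fin n) K, (∀ j ∈ g.vars, (j : ℕ) < k) →
      (∀ x ∈ V, eval x g = 0) → g = 0) :
    ∃ f : Fin (n - k) → MvPolynomial (Fin n) F,
      (∀ i : Fin (n - k),
        (∀ j ∈ (f i).vars,
          (j : ℕ) < k ∨ j = Fin.cast (Nat.add_sub_cancel' hkn) (Fin.natAdd k i)) ∧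
        (f i).totalDegree ≤ d ∧
        Fin.cast (Nat.add_sub_cancel' hkn) (Fin.natAdd k i) ∈ (f i).vars) ∧
      (V ⊆ {x : Fin n → K | ∀ i, eval x (MvPolynomial.map (algebraMap F K) (f i)) = 0} ∧
        ∀ W : Set (Fin n → K),
          W ⊆ {x : Fin n → K | ∀ i, eval x (MvPolynomial.map (algebraMap F K) (f i)) = 0} →
          IsIrreducible W → V ⊆ W → W ⊆ V) := by
  have hVc : IsClosed V := by
    obtain ⟨s, hs⟩ := hV
    exact (ICP.isClosed_iff _).2 ⟨_, hs⟩
  have hi : ∀ c : MvPolynomial (Fin k) K, c ≠ 0 →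
      rename (Fin.castLE hkn) c ∉ _root_.vanishingIdeal K n V := by
    classical
    intro c hc h
    apply hc
    apply rename_injective _ (Fin.castLE_injective hkn)
    rw [map_zero]
    refine hindep _ (fun j hj => ?_) h
    obtain ⟨i, -, rfl⟩ := Finset.mem_image.1 (vars_rename _ _ hj)
    exact i.2
  have hdesc : ∀ j0 : Fin n, ¬ (j0 : ℕ) < k → ∃ g : MvPolynomial (Fin n) F,
      (∀ j ∈ g.vars, (j : ℕ) < k ∨ j = j0) ∧ g.totalDegree ≤ d ∧ j0 ∈ g.vars ∧
      MvPolynomial.map (algebraMap F K) g ∈ _root_.vanishingIdeal K n V := by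
    classical
    intro j0 hj0
    obtain ⟨f, hfV, hf0, hfd⟩ := ICP.core hkn V hVc hirr hVdim hVdeg hi j0 hj0
    set G := rename (fun o : Option (Fin k) => o.elim j0 (Fin.castLE hkn)) f with hG
    have hvars : ∀ j ∈ G.vars, (j : ℕ) < k ∨ j = j0 := by
      intro j hj
      obtain ⟨o, -, rfl⟩ := Finset.mem_image.1 (vars_rename _ _ hj)
      rcases o with _ | i
      · exact Or.inr rfl
      · exact Or.inl i.2
    have hj0v : j0 ∈ G.vars := by
      by_contra h
      have hG0 : G = 0 := hindep G (fun j hj => (hvars j hj).resolve_right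
        (fun e => h (e ▸ hj))) hfV
      apply hf0
      apply rename_injective _ (ICP.idx_inj hkn j0 hj0)
      rw [map_zero]
      exact hG0
    obtain ⟨m, hm, hmj⟩ := (mem_vars_iff_mem_support _).1 hj0v
    obtain ⟨g, hgV, hgs, hgm⟩ := ICP.descend V hF G hfV m hm
    refine ⟨g, fun j hj => ?_, ?_, (mem_vars_iff_mem_support _).2 ⟨m, hgm, hmj⟩, hgV⟩
    · obtain ⟨m', hm', hj'⟩ := (mem_vars_iff_mem_support _).1 hj
      exact hvars j ((mem_vars_iff_mem_support _).2 ⟨m', hgs hm', hj'⟩)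
    · exact (Finset.sup_mono hgs).trans ((totalDegree_rename_le _ f).trans hfd)
  have hge : ∀ i : Fin (n - k),
      ¬ ((Fin.cast (Nat.add_sub_cancel' hkn) (Fin.natAdd k i) : Fin n) : ℕ) < k := by
    intro i; simp
  choose f hf1 hf2 hf3 hf4 using fun i => hdesc _ (hge i)
  refine ⟨f, fun i => ⟨hf1 i, hf2 i, hf3 i⟩, fun x hx i => hf4 i x hx, ?_⟩
  intro W hWU hW hVW
  have hQ := ICP.prime_of_irr hW
  have hle : _root_.vanishingIdeal K n V ≤ _root_.vanishingIdeal K n W := by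
    intro g hg
    by_contra hgW
    obtain ⟨c, hc, b, hb⟩ := ICP.elim (Fin.castLE hkn) (_root_.vanishingIdeal K n W) (by
      intro j
      by_cases hj : (j : ℕ) < k
      · refine ⟨X none - X (some ⟨j, hj⟩), ?_, ?_⟩
        · rw [sub_ne_zero]
          intro h
          simpa using X_injective h
        · have : Fin.castLE hkn ⟨j, hj⟩ = j := rfl
          simp [this]
      · have hlt : (j : ℕ) - k < n - k := by omega
        have hji : (Fin.cast (Nat.add_sub_cancel' hkn) (Fin.natAdd k ⟨j - k, hlt⟩) : Fin n) = j := by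
          ext; simp; omega
        have h1 := hf1 ⟨j - k, hlt⟩
        have h3 := hf3 ⟨j - k, hlt⟩
        rw [hji] at h1 h3
        obtain ⟨G, hG⟩ := exists_rename_eq_of_vars_subset_range
          (MvPolynomial.map (algebraMap F K) (f ⟨j - k, hlt⟩))
          (fun o : Option (Fin k) => o.elim j (Fin.castLE hkn)) (ICP.idx_inj hkn j hj) (by
            intro j' hj'
            rcases h1 j' (vars_map _ _ hj') with h | h
            · exact ⟨some ⟨j', h⟩, rfl⟩
            · exact ⟨none, h.symm⟩)
        refine ⟨G, ?_, ?_⟩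
        · rintro rfl
          rw [map_zero] at hG
          have : f ⟨j - k, hlt⟩ = 0 := by
            apply map_injective _ (algebraMap F K).injective
            rw [map_zero, ← hG]
          rw [this] at h3
          simp at h3
        · rw [hG]
          intro x hx
          exact hWU hx _) g hgW
    apply hi c hc
    intro x hx
    have h1 := hb x (hVW hx)
    rw [map_sub, map_mul, hg x hx, mul_zero, sub_zero] at h1
    exact h1
  intro x hx
  rw [← ICP.closed_eq hVc]
  intro g hg
  exact hle hg x hx
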